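/- The itinerary map 𝓘 is everywhere continuous from the right, the itinerary map 𝓘̃ is everywhere continuous from the left, and on the set R of regular points the maps 𝓘 and 𝓘̃ are equal and continuous. -/

import Mathlib

open Set

noncomputable section

/-- `bpt a k = a_1 + ⋯ + a_k` (0-indexed: the sum of the first `k` entries of `a`);
these are the division points `b_k` of the interval exchange. -/
def bpt {n : ℕ} (a : Fin n → ℝ) (k : ℕ) : ℝ :=
  ∑ j ∈ Finset.univ.filter (fun j : Fin n => (j : ℕ) < k), a j

/-- The left-closed right-open interval `J_i = [b_{i-1}, b_i)` (0-indexed). -/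
def Jint {n : ℕ} (a : Fin n → ℝ) (i : Fin n) : Set ℝ :=
  Set.Ico (bpt a (i : ℕ)) (bpt a ((i : ℕ) + 1))

/-- The left-open right-closed interval `J̃_i = (b_{i-1}, b_i]` (0-indexed). -/
def Jtil {n : ℕ} (a : Fin n → ℝ) (i : Fin n) : Set ℝ :=
  Set.Ioc (bpt a (i : ℕ)) (bpt a ((i : ℕ) + 1))

/-- The permuted probability vector `a^τ`, with `a^τ_{τ(i)} = a_i`. -/
def aperm {n : ℕ} (a : Fin n → ℝ) (τ : Equiv.Perm (Fin n)) : Fin n → ℝ :=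
  fun j => a (τ.symm j)

/-- The set `D = {b_1, …, b_{n-1}}` of interior division points. -/
def Dset {n : ℕ} (a : Fin n → ℝ) : Set ℝ :=
  {x | ∃ k : ℕ, 0 < k ∧ k < n ∧ x = bpt a k}

/-- `a` is a positive probability vector. -/
def IsProbVec {n : ℕ} (a : Fin n → ℝ) : Prop :=
  (∀ i, 0 < a i) ∧ ∑ i, a i = 1

/-- `T` is the Lr `(a,τ)` interval exchange transformation: on each
`J_i = [b_{i-1}, b_i)` it is the translation `x ↦ x - b_{i-1} + b^τ_{τ(i)-1}`. -/
def IsLrIET {n : ℕ} (a : Fin n → ℝ) (τ : Equiv.Perm (Fin n)) (T : ℝ → ℝ) : Prop :=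
  ∀ i : Fin n, ∀ x ∈ Jint a i, T x = x - bpt a (i : ℕ) + bpt (aperm a τ) ((τ i : ℕ))

/-- `Tt` is the dual lR `(a,τ)` interval exchange transformation: on each
`J̃_i = (b_{i-1}, b_i]` it is the translation `x ↦ x - b_{i-1} + b^τ_{τ(i)-1}`. -/
def IslRIET {n : ℕ} (a : Fin n → ℝ) (τ : Equiv.Perm (Fin n)) (Tt : ℝ → ℝ) : Prop :=
  ∀ i : Fin n, ∀ x ∈ Jtil a i, Tt x = x - bpt a (i : ℕ) + bpt (aperm a τ) ((τ i : ℕ))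

/-- The Keane Condition: `D ∩ T^k(D) = ∅` for every positive integer `k`. -/
def KeaneCond {n : ℕ} (a : Fin n → ℝ) (T : ℝ → ℝ) : Prop :=
  ∀ k : ℕ, 0 < k → Dset a ∩ (T^[k] '' Dset a) = ∅

/-- `τ` is irreducible: `τ({1,…,j}) ≠ {1,…,j}` for `j = 1, …, n-1` (0-indexed:
no proper initial segment is invariant). -/
def IrreduciblePerm {n : ℕ} (τ : Equiv.Perm (Fin n)) : Prop :=
  ∀ j : ℕ, 0 < j → j < n →
    (fun i => τ i) '' {i : Fin n | (i : ℕ) < j} ≠ {i : Fin n | (i : ℕ) < j}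

/-- `P` is the family of ℤ-iterates of `T` on `[0,1)`: `P 0 = id`,
`P (k+1) = T ∘ P k`, and each `P k` maps `[0,1)` into itself. -/
def IsZIterLr (T : ℝ → ℝ) (P : ℤ → ℝ → ℝ) : Prop :=
  (∀ x ∈ Set.Ico (0 : ℝ) 1, P 0 x = x) ∧
  ∀ k : ℤ, ∀ x ∈ Set.Ico (0 : ℝ) 1, P k x ∈ Set.Ico (0 : ℝ) 1 ∧ P (k + 1) x = T (P k x)

/-- `Pt` is the family of ℤ-iterates of `Tt` on `(0,1]`. -/
def IsZIterlR (Tt : ℝ → ℝ) (Pt : ℤ → ℝ → ℝ) : Prop :=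
  (∀ x ∈ Set.Ioc (0 : ℝ) 1, Pt 0 x = x) ∧
  ∀ k : ℤ, ∀ x ∈ Set.Ioc (0 : ℝ) 1, Pt k x ∈ Set.Ioc (0 : ℝ) 1 ∧ Pt (k + 1) x = Tt (Pt k x)

/-- `I` is the itinerary map of `T` (with ℤ-iterates `P`):
`𝓘(x)_k = i ↔ T^k x ∈ J_i` for `x ∈ [0,1)`. -/
def IsItin {n : ℕ} (a : Fin n → ℝ) (P : ℤ → ℝ → ℝ) (I : ℝ → ℤ → Fin n) : Prop :=
  ∀ x ∈ Set.Ico (0 : ℝ) 1, ∀ k : ℤ, ∀ i : Fin n, (I x k = i ↔ P k x ∈ Jint a i)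

/-- `It` is the itinerary map of `Tt` (with ℤ-iterates `Pt`):
`𝓘̃(x)_k = i ↔ T̃^k x ∈ J̃_i` for `x ∈ (0,1]`. -/
def IsItinDual {n : ℕ} (a : Fin n → ℝ) (Pt : ℤ → ℝ → ℝ) (It : ℝ → ℤ → Fin n) : Prop :=
  ∀ x ∈ Set.Ioc (0 : ℝ) 1, ∀ k : ℤ, ∀ i : Fin n, (It x k = i ↔ Pt k x ∈ Jtil a i)

/-- `D_∞ = {0,1} ∪ ⋃_{k ∈ ℤ} T^k(D)`. -/
def Dinf {n : ℕ} (a : Fin n → ℝ) (P : ℤ → ℝ → ℝ) : Set ℝ :=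
  {0, 1} ∪ ⋃ k : ℤ, P k '' Dset a

/-- The set `R = [0,1] ∖ D_∞` of regular points. -/
def Rset {n : ℕ} (a : Fin n → ℝ) (P : ℤ → ℝ → ℝ) : Set ℝ :=
  Set.Icc 0 1 \ Dinf a P

/-- The shift `S` on `Ω = {1,…,n}^ℤ`: `S(α)_i = α_{i+1}`. -/
def shiftS {n : ℕ} (α : ℤ → Fin n) : ℤ → Fin n := fun i => α (i + 1)

/-- The `k`-th power of the shift: `(S^k α)_i = α_{i+k}`. -/
def shiftZ {n : ℕ} (k : ℤ) (α : ℤ → Fin n) : ℤ → Fin n := fun i => α (i + k)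

/-- `α, β` are positively asymptotic: `α_i = β_i` for all `i ≥ N`, some `N`. -/
def PosAsymp {n : ℕ} (α β : ℤ → Fin n) : Prop :=
  ∃ N : ℕ, ∀ i : ℤ, (N : ℤ) ≤ i → α i = β i

/-- `α, β` are negatively asymptotic: `α_i = β_i` for all `i ≤ -N`, some `N`. -/
def NegAsymp {n : ℕ} (α β : ℤ → Fin n) : Prop :=
  ∃ N : ℕ, ∀ i : ℤ, i ≤ -(N : ℤ) → α i = β i

lemma bpt_zero {n : ℕ} (a : Fin n → ℝ) : bpt a 0 = 0 := by simp [bpt]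

lemma bpt_top {n : ℕ} (a : Fin n → ℝ) : bpt a n = ∑ i, a i := by simp [bpt]

lemma bpt_succ {n : ℕ} (a : Fin n → ℝ) (i : Fin n) :
    bpt a ((i : ℕ) + 1) = bpt a i + a i := by
  have h : Finset.univ.filter (fun j : Fin n => (j : ℕ) < (i : ℕ) + 1) =
      insert i (Finset.univ.filter (fun j : Fin n => (j : ℕ) < (i : ℕ))) := by
    ext j
    simp only [Finset.mem_filter, Finset.mem_univ, true_and, Finset.mem_insert, Fin.ext_iff]
    omega
  rw [bpt, h, Finset.sum_insert (by simp), add_comm, bpt]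

lemma bpt_mono {n : ℕ} {a : Fin n → ℝ} (ha : ∀ i, 0 ≤ a i) : Monotone (bpt a) := by
  intro k l hkl
  refine Finset.sum_le_sum_of_subset_of_nonneg ?_ fun i _ _ => ha i
  intro j hj
  simp only [Finset.mem_filter, Finset.mem_univ, true_and] at hj ⊢
  omega

lemma bpt_nonneg {n : ℕ} {a : Fin n → ℝ} (ha : ∀ i, 0 ≤ a i) (k : ℕ) : 0 ≤ bpt a k :=
  Finset.sum_nonneg fun i _ => ha i

lemma bpt_succ_le_one {n : ℕ} {a : Fin n → ℝ} (ha : IsProbVec a) (i : Fin n) :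
    bpt a ((i : ℕ) + 1) ≤ 1 := by
  rw [← ha.2, ← bpt_top]
  exact bpt_mono (fun i => (ha.1 i).le) i.2

lemma Jint_subset {n : ℕ} {a : Fin n → ℝ} (ha : IsProbVec a) (i : Fin n) :
    Jint a i ⊆ Ico 0 1 :=
  Ico_subset_Ico (bpt_nonneg (fun i => (ha.1 i).le) _) (bpt_succ_le_one ha i)

lemma Jtil_subset {n : ℕ} {a : Fin n → ℝ} (ha : IsProbVec a) (i : Fin n) :
    Jtil a i ⊆ Ioc 0 1 :=
  Ioc_subset_Ioc (bpt_nonneg (fun i => (ha.1 i).le) _) (bpt_succ_le_one ha i)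

lemma Jint_unique {n : ℕ} {a : Fin n → ℝ} (ha : ∀ i, 0 ≤ a i) {i j : Fin n} {x : ℝ}
    (hi : x ∈ Jint a i) (hj : x ∈ Jint a j) : i = j := by
  rcases lt_trichotomy i j with h | h | h
  · have := bpt_mono ha (Nat.succ_le_of_lt (Fin.lt_def.1 h))
    exact absurd (hi.2.trans_le (this.trans hj.1)) (lt_irrefl _)
  · exact h
  · have := bpt_mono ha (Nat.succ_le_of_lt (Fin.lt_def.1 h))
    exact absurd (hj.2.trans_le (this.trans hi.1)) (lt_irrefl _)

lemma Jtil_unique {n : ℕ} {a : Fin n → ℝ} (ha : ∀ i, 0 ≤ a i) {i j : Fin n} {x : ℝ}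
    (hi : x ∈ Jtil a i) (hj : x ∈ Jtil a j) : i = j := by
  rcases lt_trichotomy i j with h | h | h
  · have := bpt_mono ha (Nat.succ_le_of_lt (Fin.lt_def.1 h))
    exact absurd (hj.1.trans_le (hi.2.trans this)) (lt_irrefl _)
  · exact h
  · have := bpt_mono ha (Nat.succ_le_of_lt (Fin.lt_def.1 h))
    exact absurd (hi.1.trans_le (hj.2.trans this)) (lt_irrefl _)

lemma aperm_nonneg {n : ℕ} {a : Fin n → ℝ} (ha : IsProbVec a) (τ : Equiv.Perm (Fin n))
    (i : Fin n) : 0 ≤ aperm a τ i := (ha.1 _).le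

lemma bpt_aperm_succ {n : ℕ} (a : Fin n → ℝ) (τ : Equiv.Perm (Fin n)) (i : Fin n) :
    bpt (aperm a τ) ((τ i : ℕ) + 1) = bpt (aperm a τ) (τ i : ℕ) + a i := by
  rw [bpt_succ, aperm, Equiv.symm_apply_apply]

lemma IsLrIET.mem_Jint {n : ℕ} {a : Fin n → ℝ} {τ : Equiv.Perm (Fin n)} {T : ℝ → ℝ}
    (hT : IsLrIET a τ T) {i : Fin n} {x : ℝ} (hx : x ∈ Jint a i) :
    T x ∈ Jint (aperm a τ) (τ i) := by
  rw [hT i x hx]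
  obtain ⟨h₁, h₂⟩ := hx
  rw [bpt_succ] at h₂
  refine ⟨by linarith, ?_⟩
  rw [bpt_aperm_succ]
  linarith

lemma IslRIET.mem_Jtil {n : ℕ} {a : Fin n → ℝ} {τ : Equiv.Perm (Fin n)} {T : ℝ → ℝ}
    (hT : IslRIET a τ T) {i : Fin n} {x : ℝ} (hx : x ∈ Jtil a i) :
    T x ∈ Jtil (aperm a τ) (τ i) := by
  rw [hT i x hx]
  obtain ⟨h₁, h₂⟩ := hx
  rw [bpt_succ] at h₂
  refine ⟨by linarith, ?_⟩
  rw [bpt_aperm_succ]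
  linarith

lemma IsLrIET.injOn {n : ℕ} {a : Fin n → ℝ} (ha : IsProbVec a) {τ : Equiv.Perm (Fin n)}
    {T : ℝ → ℝ} (hT : IsLrIET a τ T) : InjOn T (⋃ i, Jint a i) := by
  intro x hx y hy hxy
  obtain ⟨i, hi⟩ := mem_iUnion.1 hx
  obtain ⟨j, hj⟩ := mem_iUnion.1 hy
  obtain rfl : i = j := τ.injective
    (Jint_unique (aperm_nonneg ha τ) (hT.mem_Jint hi) (hxy ▸ hT.mem_Jint hj))
  rw [hT i x hi, hT i y hj] at hxy
  linarith

lemma IslRIET.injOn {n : ℕ} {a : Fin n → ℝ} (ha : IsProbVec a) {τ : Equiv.Perm (Fin n)}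
    {T : ℝ → ℝ} (hT : IslRIET a τ T) : InjOn T (⋃ i, Jtil a i) := by
  intro x hx y hy hxy
  obtain ⟨i, hi⟩ := mem_iUnion.1 hx
  obtain ⟨j, hj⟩ := mem_iUnion.1 hy
  obtain rfl : i = j := τ.injective
    (Jtil_unique (aperm_nonneg ha τ) (hT.mem_Jtil hi) (hxy ▸ hT.mem_Jtil hj))
  rw [hT i x hi, hT i y hj] at hxy
  linarith

/-- Two bi-infinite orbits of an injective map that agree at time `0` agree at all times. -/
lemma orbit_unique {S : Set ℝ} {T : ℝ → ℝ} (hinj : InjOn T S) {u v : ℤ → ℝ}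
    (hu : ∀ k, u k ∈ S ∧ u (k + 1) = T (u k)) (hv : ∀ k, v k ∈ S ∧ v (k + 1) = T (v k))
    (h0 : u 0 = v 0) (k : ℤ) : u k = v k := by
  induction k using Int.induction_on with
  | zero => exact h0
  | succ k ih => rw [(hu k).2, (hv k).2, ih]
  | pred k ih =>
    refine hinj (hu _).1 (hv _).1 ?_
    rw [← (hu _).2, ← (hv _).2, sub_add_cancel]
    exact ih

/-- The iterates satisfy the group law. -/
lemma iter_add {S : Set ℝ} {T : ℝ → ℝ} {P : ℤ → ℝ → ℝ} (hinj : InjOn T S)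
    (h0 : ∀ x ∈ S, P 0 x = x) (hP : ∀ k : ℤ, ∀ x ∈ S, P k x ∈ S ∧ P (k + 1) x = T (P k x))
    {x : ℝ} (hx : x ∈ S) (j k : ℤ) : P j (P k x) = P (j + k) x := by
  refine orbit_unique hinj (u := fun j => P j (P k x)) (v := fun j => P (j + k) x)
    (fun j => hP j _ (hP k x hx).1) (fun j => ⟨(hP _ x hx).1, ?_⟩) ?_ j
  · rw [← (hP _ x hx).2]
    congr 1
    ring
  · simp only [zero_add]
    exact h0 _ (hP k x hx).1

/-- If, for `y` along the filter `F`, each point `P k x + (y - x)` stays in the interval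
containing `P k x`, then the itineraries of `y` converge along `F` to that of `x`. -/
lemma tendsto_itinerary {n : ℕ} {S : Set ℝ} {T : ℝ → ℝ} {P : ℤ → ℝ → ℝ} {J : Fin n → Set ℝ}
    {c : Fin n → ℝ} {I : ℝ → ℤ → Fin n} {F : Filter ℝ} {x : ℝ}
    (hinj : InjOn T S) (h0 : ∀ x ∈ S, P 0 x = x)
    (hP : ∀ k : ℤ, ∀ x ∈ S, P k x ∈ S ∧ P (k + 1) x = T (P k x))
    (hJ : ∀ i, J i ⊆ S) (hT : ∀ i, ∀ x ∈ J i, T x = x + c i)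
    (hI : ∀ x ∈ S, ∀ k i, I x k = i ↔ P k x ∈ J i) (hx : x ∈ S)
    (hF : ∀ k i, P k x ∈ J i → ∀ᶠ y in F, P k x + (y - x) ∈ J i) :
    Filter.Tendsto I F (nhds (I x)) := by
  have hmem : ∀ k, P k x ∈ J (I x k) := fun k => (hI x hx k _).1 rfl
  have hS : ∀ᶠ y in F, y ∈ S := by
    filter_upwards [hF 0 _ (hmem 0)] with y hy
    rw [h0 x hx, add_sub_cancel] at hy
    exact hJ _ hy
  have htrans : ∀ k, ∀ᶠ y in F, P k y = P k x + (y - x) := by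
    intro k
    induction k using Int.induction_on with
    | zero =>
      filter_upwards [hS] with y hy
      rw [h0 x hx, h0 y hy, add_sub_cancel]
    | succ k ih =>
      filter_upwards [hS, ih, hF k _ (hmem k)] with y hy hk hm
      rw [(hP _ y hy).2, (hP _ x hx).2, hk, hT _ _ hm, hT _ _ (hmem k)]
      ring
    | pred k ih =>
      filter_upwards [hS, ih, hF _ _ (hmem (-(k : ℤ) - 1))] with y hy hk hm
      refine hinj (hP _ y hy).1 (hJ _ hm) ?_
      rw [← (hP _ y hy).2, sub_add_cancel, hk, hT _ _ hm]
      have h := (hP (-(k : ℤ) - 1) x hx).2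
      rw [sub_add_cancel, hT _ _ (hmem _)] at h
      rw [h]
      ring
  rw [tendsto_pi_nhds]
  intro k
  refine tendsto_nhds_of_eventually_eq ?_
  filter_upwards [hS, htrans k, hF k _ (hmem k)] with y hy hk hm
  rw [hI y hy, hk]
  exact hm

lemma tendsto_translate (p x : ℝ) :
    Filter.Tendsto (fun y => p + (y - x)) (nhds x) (nhds p) := by
  have h : Continuous fun y : ℝ => p + (y - x) := by fun_prop
  simpa using h.tendsto x

/-- The forward and backward orbit of a regular point avoids the left endpoints of the
intervals `J_i`. -/
lemma orbit_ne_bpt {n : ℕ} {a : Fin n → ℝ} (ha : IsProbVec a) {τ : Equiv.Perm (Fin n)}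
    {T : ℝ → ℝ} (hT : IsLrIET a τ T) {P : ℤ → ℝ → ℝ} (hP : IsZIterLr T P)
    (hcover : Ico (0 : ℝ) 1 ⊆ ⋃ i, Jint a i) {x : ℝ} (hx : x ∈ Ico (0 : ℝ) 1)
    (hR : x ∈ Rset a P) (k : ℤ) (i : Fin n) : P k x ≠ bpt a i := by
  have hnn : ∀ i, 0 ≤ a i := fun i => (ha.1 i).le
  have hinj : InjOn T (Ico 0 1) := (hT.injOn ha).mono hcover
  have hD : ∀ k, P k x ∉ Dset a := fun k hk => hR.2 <| Or.inr <| mem_iUnion.2 ⟨-k, P k x, hk, by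
    rw [iter_add hinj hP.1 hP.2 hx, neg_add_cancel, hP.1 x hx]⟩
  have hpred : ∀ k, P (k + 1) x = 0 → P k x = 0 := by
    intro k hk
    obtain ⟨i, hi⟩ := mem_iUnion.1 (hcover (hP.2 k x hx).1)
    rw [(hP.2 k x hx).2, hT i _ hi] at hk
    have h₁ := hi.1
    have h₂ := bpt_nonneg (aperm_nonneg ha τ) (τ i : ℕ)
    have hp : P k x = bpt a i := by linarith
    rcases Nat.eq_zero_or_pos (i : ℕ) with h | h
    · rw [hp, h, bpt_zero]
    · exact absurd ⟨i, h, i.2, hp⟩ (hD k)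
  have hne : ∀ k, P k x ≠ 0 := by
    intro k
    induction k using Int.induction_on with
    | zero =>
      rw [hP.1 x hx]
      exact fun h => hR.2 (Or.inl (Or.inl h))
    | succ k ih => exact fun h => ih (hpred _ h)
    | pred k ih =>
      intro h
      have h' := hpred (-(k : ℤ) - 1 - 1) (by rwa [sub_add_cancel])
      have e₁ := (hP.2 (-(k : ℤ) - 1 - 1) x hx).2
      have e₂ := (hP.2 (-(k : ℤ) - 1) x hx).2
      rw [sub_add_cancel] at e₁ e₂
      rw [h, h'] at e₁
      rw [h, ← e₁] at e₂
      exact ih e₂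
  intro h
  rcases Nat.eq_zero_or_pos (i : ℕ) with h' | h'
  · rw [h', bpt_zero] at h
    exact hne k h
  · exact hD k ⟨i, h', i.2, h⟩

/-- Proposition 4.1: the itinerary map `𝓘` is everywhere continuous
from the right, `𝓘̃` is everywhere continuous from the left, and on the set `R` of
regular points the maps `𝓘` and `𝓘̃` are equal and continuous. -/
theorem stmt9 {n : ℕ} (hn : 2 ≤ n) (a : Fin n → ℝ) (ha : IsProbVec a)
    (τ : Equiv.Perm (Fin n)) (T Tt : ℝ → ℝ)
    (hT : IsLrIET a τ T) (hTt : IslRIET a τ Tt)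
    (P Pt : ℤ → ℝ → ℝ) (hP : IsZIterLr T P) (hPt : IsZIterlR Tt Pt)
    (I It : ℝ → ℤ → Fin n) (hI : IsItin a P I) (hIt : IsItinDual a Pt It) :
    (∀ x ∈ Set.Ico (0 : ℝ) 1, ContinuousWithinAt I (Set.Ici x) x) ∧
    (∀ x ∈ Set.Ioc (0 : ℝ) 1, ContinuousWithinAt It (Set.Iic x) x) ∧
    (∀ x ∈ Rset a P, I x = It x ∧ ContinuousAt I x ∧ ContinuousAt It x) := by
  have hcover : Ico (0 : ℝ) 1 ⊆ ⋃ i, Jint a i := fun x hx => mem_iUnion.2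
    ⟨I x 0, by simpa only [hP.1 x hx] using (hI x hx 0 _).1 rfl⟩
  have hcover' : Ioc (0 : ℝ) 1 ⊆ ⋃ i, Jtil a i := fun x hx => mem_iUnion.2
    ⟨It x 0, by simpa only [hPt.1 x hx] using (hIt x hx 0 _).1 rfl⟩
  have hinj : InjOn T (Ico 0 1) := (hT.injOn ha).mono hcover
  have hinj' : InjOn Tt (Ioc 0 1) := (hTt.injOn ha).mono hcover'
  have hT' : ∀ i, ∀ x ∈ Jint a i, T x = x + (bpt (aperm a τ) (τ i : ℕ) - bpt a i) :=
    fun i x hx => by rw [hT i x hx]; ring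
  have hTt' : ∀ i, ∀ x ∈ Jtil a i, Tt x = x + (bpt (aperm a τ) (τ i : ℕ) - bpt a i) :=
    fun i x hx => by rw [hTt i x hx]; ring
  refine ⟨fun x hx => ?_, fun x hx => ?_, fun x hR => ?_⟩
  · refine tendsto_itinerary hinj hP.1 hP.2 (Jint_subset ha) hT' hI hx fun k i hi => ?_
    filter_upwards [self_mem_nhdsWithin, nhdsWithin_le_nhds
      ((tendsto_translate (P k x) x).eventually (gt_mem_nhds hi.2))] with y hy hlt
    have h₁ := hi.1
    have h₂ : x ≤ y := hy
    exact ⟨by linarith, hlt⟩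
  · refine tendsto_itinerary hinj' hPt.1 hPt.2 (Jtil_subset ha) hTt' hIt hx fun k i hi => ?_
    filter_upwards [self_mem_nhdsWithin, nhdsWithin_le_nhds
      ((tendsto_translate (Pt k x) x).eventually (lt_mem_nhds hi.1))] with y hy hlt
    have h₁ := hi.2
    have h₂ : y ≤ x := hy
    exact ⟨hlt, by linarith⟩
  · have hx0 : x ≠ 0 := fun h => hR.2 (Or.inl (Or.inl h))
    have hx1 : x ≠ 1 := fun h => hR.2 (Or.inl (Or.inr h))
    have hx : x ∈ Ico (0 : ℝ) 1 := ⟨hR.1.1, lt_of_le_of_ne hR.1.2 hx1⟩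
    have hx' : x ∈ Ioc (0 : ℝ) 1 := ⟨lt_of_le_of_ne hR.1.1 hx0.symm, hR.1.2⟩
    have hIoo : ∀ k, P k x ∈ Ioo (bpt a (I x k : ℕ)) (bpt a ((I x k : ℕ) + 1)) := fun k =>
      have h : P k x ∈ Jint a (I x k) := (hI x hx k _).1 rfl
      ⟨lt_of_le_of_ne h.1 (orbit_ne_bpt ha hT hP hcover hx hR k _).symm, h.2⟩
    have htil : ∀ k, P k x ∈ Jtil a (I x k) := fun k => Ioo_subset_Ioc_self (hIoo k)
    have hPP : ∀ k, P k x = Pt k x := by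
      refine orbit_unique hinj' (u := fun k => P k x) (v := fun k => Pt k x)
        (fun k => ⟨Jtil_subset ha _ (htil k), ?_⟩) (fun k => hPt.2 k x hx') ?_
      · rw [(hP.2 k x hx).2, hTt' _ _ (htil k), hT' _ _ (Ioo_subset_Ico_self (hIoo k))]
      · simp only [hP.1 x hx, hPt.1 x hx']
    have hII : I x = It x := by
      funext k
      exact ((hIt x hx' k _).2 (hPP k ▸ htil k)).symm
    have hev : ∀ k, ∀ᶠ y in nhds x,
        P k x + (y - x) ∈ Ioo (bpt a (I x k : ℕ)) (bpt a ((I x k : ℕ) + 1)) := fun k =>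
      (tendsto_translate (P k x) x).eventually (Ioo_mem_nhds (hIoo k).1 (hIoo k).2)
    refine ⟨hII, ?_, ?_⟩
    · refine tendsto_itinerary hinj hP.1 hP.2 (Jint_subset ha) hT' hI hx fun k i hi => ?_
      obtain rfl := (hI x hx k i).2 hi
      exact (hev k).mono fun y hy => Ioo_subset_Ico_self hy
    · refine tendsto_itinerary hinj' hPt.1 hPt.2 (Jtil_subset ha) hTt' hIt hx' fun k i hi => ?_
      obtain rfl := (hIt x hx' k i).2 hi
      rw [← hPP k, ← hII]
      exact (hev k).mono fun y hy => Ioo_subset_Ioc_self hy
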